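/- Let F ∈ R = K[x_1,...,x_n] be a homogeneous polynomial of degree n, and let f_1, ..., f_n be homogeneous quadratic forms with f_i∘F = 0 for each i (i.e. f_1,...,f_n ∈ Q(F)) which form a regular sequence in R. Then Ann_R(F) is equal to the ideal (f_1, ..., f_n) generated by them; in particular A(F) = R/(f_1,...,f_n) is a quadratic complete intersection. -/

import Mathlib

open MvPolynomial

noncomputable section

variable {K : Type} [Field K] {n : ℕ}

/-- The endomorphism `∂^d = ∏ i, (∂/∂x_i)^{d i}`. -/
def monOp (n : ℕ) (K : Type) [CommSemiring K] (d : Fin n →₀ ℕ) :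
    Module.End K (MvPolynomial (Fin n) K) :=
  ((List.finRange n).map fun i =>
    ((MvPolynomial.pderiv i).toLinearMap : Module.End K (MvPolynomial (Fin n) K)) ^ d i).prod

/-- `contr F f = f(∂/∂x₁, …, ∂/∂xₙ) F`, i.e. the result of applying to `F` the
constant-coefficient differential operator obtained from `f` by substituting
`∂/∂x_i` for `x_i`; it is a linear map in `f`. -/
def contr (F : MvPolynomial (Fin n) K) :
    MvPolynomial (Fin n) K →ₗ[K] MvPolynomial (Fin n) K :=
  (basisMonomials (Fin n) K).constr K fun d => monOp n K d F

end

section ExtOfRegularSequence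

open CategoryTheory CategoryTheory.Abelian RingTheory.Sequence

variable {R : Type} [CommRing R]

/-- Multiplication by an element annihilating `N` kills `Ext N M i`. -/
theorem ext_comp_smulShortComplex_f_eq_zero {N : ModuleCat.{0} R} {r : R}
    (hr : r ∈ Module.annihilator R N) (M : ModuleCat.{0} R) (i : ℕ) (x : Ext N M i) :
    x.comp (Ext.mk₀ (M.smulShortComplex r).f) (add_zero i) = 0 :=
  congrArg (fun g => g.hom x) (Ext.postcomp_smul_id_eq_zero_of_mem_annihilator hr i)

/-- The connecting map of `0 → M → M → M/rM → 0` is an isomorphism in the first degree in which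
`Ext N M` may be nonzero. -/
noncomputable def extQuotSMulTopEquiv {N M : ModuleCat.{0} R} {r : R}
    (hr : r ∈ Module.annihilator R N) (hreg : IsSMulRegular M r) (i : ℕ)
    (hi : Subsingleton (Ext N M i)) :
    Ext N (ModuleCat.of R (QuotSMulTop r M)) i ≃ₗ[R] Ext N M (i + 1) :=
  let S := hreg.smulShortComplex_shortExact
  let δ : Ext N (M.smulShortComplex r).X₃ i →ₗ[R] Ext N (M.smulShortComplex r).X₁ (i + 1) :=
    { toFun := fun x => x.comp S.extClass rfl
      map_add' := fun _ _ => Ext.add_comp _ _ _ _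
      map_smul' := fun _ _ => Ext.smul_comp _ _ _ _ }
  LinearEquiv.ofBijective δ
    ⟨(injective_iff_map_eq_zero δ).mpr fun x hx => by
        obtain ⟨y, rfl⟩ := Ext.covariant_sequence_exact₃ N S x rfl hx
        rw [show y = 0 from hi.elim _ _, Ext.zero_comp],
      fun x => Ext.covariant_sequence_exact₁ N S x
        (ext_comp_smulShortComplex_f_eq_zero hr M _ x) rfl⟩

theorem ext_of_isWeaklyRegular (N : ModuleCat.{0} R) (rs : List R)
    (hrs : ∀ r ∈ rs, r ∈ Module.annihilator R N) (M : ModuleCat.{0} R)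
    (h : IsWeaklyRegular M rs) :
    (∀ i < rs.length, Subsingleton (Ext N M i)) ∧
      Nonempty ((N →ₗ[R] M ⧸ (Ideal.ofList rs • ⊤ : Submodule R M)) ≃ₗ[R]
        Ext N M rs.length) := by
  induction rs generalizing M with
  | nil =>
    refine ⟨by simp, ⟨?_⟩⟩
    exact (LinearEquiv.congrRight (Submodule.quotEquivOfEqBot _ (by simp))).trans
      ((Ext.linearEquiv₀ (R := R)).trans (ModuleCat.homLinearEquiv (S := R))).symm
  | cons r rs ih =>
    rw [isWeaklyRegular_cons_iff] at h
    have hr := hrs r List.mem_cons_self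
    obtain ⟨hvan, ⟨e⟩⟩ := ih (fun s hs => hrs s (List.mem_cons_of_mem _ hs))
      (ModuleCat.of R (QuotSMulTop r M)) h.2
    have hvan' : ∀ i < rs.length + 1, Subsingleton (Ext N M i) := by
      intro i hi
      induction i with
      | zero =>
        have := IsSMulRegular.linearMap_subsingleton_of_mem_annihilator h.1 hr
        exact (Ext.addEquiv₀.trans ModuleCat.homAddEquiv).subsingleton
      | succ i hi' =>
        have := hvan i (by omega)
        exact (extQuotSMulTopEquiv hr h.1 i (hi' (by omega))).symm.toEquiv.subsingleton
    exact ⟨hvan', ⟨(LinearEquiv.congrRight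
      (Submodule.quotOfListConsSMulTopEquivQuotSMulTopInner M r rs)).trans
      (e.trans (extQuotSMulTopEquiv hr h.1 _ (hvan' _ (by omega))))⟩⟩

/-- If a weakly regular sequence `xs` generates `I`, then the socle (with respect to `I`) of the
quotient by any other weakly regular sequence in `I` of the same length is cyclic. -/
theorem exists_generator_socle {I : Ideal R} {xs rs : List R} (hxs : Ideal.ofList xs = I)
    (hx : IsWeaklyRegular R xs) (hr : IsWeaklyRegular R rs) (hlen : rs.length = xs.length)
    (hmem : ∀ r ∈ rs, r ∈ I) :
    ∃ s : R, (∀ x ∈ I, x * s ∈ Ideal.ofList rs) ∧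
      ∀ u : R, (∀ x ∈ I, x * u ∈ Ideal.ofList rs) → ∃ c, u - c * s ∈ Ideal.ofList rs := by
  have hann : Module.annihilator R (ModuleCat.of R (R ⧸ I)) = I := Ideal.annihilator_quotient
  obtain ⟨-, ⟨e₁⟩⟩ := ext_of_isWeaklyRegular (ModuleCat.of R (R ⧸ I)) rs
    (fun r h => hann.symm ▸ hmem r h) (ModuleCat.of R R) hr
  obtain ⟨-, ⟨e₂⟩⟩ := ext_of_isWeaklyRegular (ModuleCat.of R (R ⧸ I)) xs
    (fun x h => hann.symm ▸ hxs ▸ Ideal.subset_span h) (ModuleCat.of R R) hx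
  rw [hlen] at e₁
  have hrs : (Ideal.ofList rs • ⊤ : Submodule R R) = Ideal.ofList rs := by simp
  have hxs' : (Ideal.ofList xs • ⊤ : Submodule R R) = I := by simp [hxs]
  let e : ((R ⧸ I) →ₗ[R] R ⧸ Ideal.ofList rs) ≃ₗ[R] ((R ⧸ I) →ₗ[R] R ⧸ I) :=
    (LinearEquiv.congrRight (Submodule.quotEquivOfEq _ _ hrs)).symm.trans
      ((e₁.trans e₂.symm).trans (LinearEquiv.congrRight (Submodule.quotEquivOfEq _ _ hxs')))
  obtain ⟨s, hs⟩ := Ideal.Quotient.mk_surjective (e.symm LinearMap.id (1 : R ⧸ I))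
  refine ⟨s, fun x hx => ?_, fun u hu => ?_⟩
  · rw [← Ideal.Quotient.eq_zero_iff_mem, map_mul, hs, ← Ideal.Quotient.algebraMap_eq,
      ← Algebra.smul_def, ← map_smul, Algebra.smul_def, Ideal.Quotient.algebraMap_eq,
      Ideal.Quotient.eq_zero_iff_mem.mpr hx, zero_mul, map_zero]
  · let φ : (R ⧸ I) →ₗ[R] R ⧸ Ideal.ofList rs :=
      Submodule.liftQ I (LinearMap.toSpanSingleton R _ (Ideal.Quotient.mk _ u)) fun x hx => by
        simpa [Algebra.smul_def, ← map_mul, Ideal.Quotient.eq_zero_iff_mem] using hu x hx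
    have hφ : φ 1 = Ideal.Quotient.mk _ u := by
      change LinearMap.toSpanSingleton R (R ⧸ Ideal.ofList rs) (Ideal.Quotient.mk _ u) (1 : R) = _
      simp
    obtain ⟨c, hc⟩ := Ideal.Quotient.mk_surjective (e φ 1)
    have hec : e φ = c • LinearMap.id := by
      ext
      simp [← hc, Algebra.smul_def]
    refine ⟨c, ?_⟩
    rw [← Ideal.Quotient.mk_eq_mk_iff_sub_mem, map_mul, hs, ← hφ,
      ← e.symm_apply_apply φ, hec, map_smul, LinearMap.smul_apply, Algebra.smul_def]
    rfl

end ExtOfRegularSequence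

section HilbertSeries

open RingTheory.Sequence

attribute [local instance] MvPolynomial.gradedAlgebra

variable {K : Type} [Field K] {n : ℕ}

instance MvPolynomial.finite_homogeneousSubmodule (k : ℕ) :
    Module.Finite K (homogeneousSubmodule (Fin n) K k) :=
  Module.Finite.iff_fg.mpr (homogeneousSubmodule_fg (Fin n) K k)

theorem MvPolynomial.IsHomogeneous.homogeneousComponent_mul {d : ℕ} {f : MvPolynomial (Fin n) K}
    (hf : f.IsHomogeneous d) (p : MvPolynomial (Fin n) K) (k : ℕ) :
    homogeneousComponent k (f * p) =
      if d ≤ k then f * homogeneousComponent (k - d) p else 0 := by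
  simp only [← decomposition.decompose'_apply]
  exact DirectSum.coe_decompose_mul_of_left_mem (homogeneousSubmodule (Fin n) K) k hf

/-- The degree `k` part of an ideal of the polynomial ring. -/
noncomputable abbrev degreePart (J : Ideal (MvPolynomial (Fin n) K)) (k : ℕ) :
    Submodule K (MvPolynomial (Fin n) K) :=
  homogeneousSubmodule (Fin n) K k ⊓ J.restrictScalars K

instance (J : Ideal (MvPolynomial (Fin n) K)) (k : ℕ) : Module.Finite K (degreePart J k) :=
  Submodule.finiteDimensional_inf_left _ _

/-- The Hilbert series of the quotient of the polynomial ring by a homogeneous ideal. -/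
noncomputable def quotientHilbertSeries (J : Ideal (MvPolynomial (Fin n) K)) : PowerSeries ℤ :=
  PowerSeries.mk fun k => (Module.finrank K (homogeneousSubmodule (Fin n) K k) : ℤ) -
    Module.finrank K (degreePart J k)

theorem coeff_quotientHilbertSeries_eq_zero_iff (J : Ideal (MvPolynomial (Fin n) K)) (k : ℕ) :
    PowerSeries.coeff k (quotientHilbertSeries J) = 0 ↔
      ∀ p : MvPolynomial (Fin n) K, p.IsHomogeneous k → p ∈ J := by
  rw [quotientHilbertSeries, PowerSeries.coeff_mk, sub_eq_zero, Nat.cast_inj]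
  refine ⟨fun h p hp => ?_, fun h => ?_⟩
  · have := Submodule.eq_of_le_of_finrank_eq
      (inf_le_left : degreePart J k ≤ homogeneousSubmodule (Fin n) K k) h.symm
    exact (this.ge hp).2
  · rw [degreePart, inf_eq_left.mpr fun p hp => h p hp]

section

variable {J : Ideal (MvPolynomial (Fin n) K)} {d : ℕ} {f : MvPolynomial (Fin n) K}

theorem degreePart_sup_span (hJ : J.IsHomogeneous (homogeneousSubmodule (Fin n) K))
    (hf : f.IsHomogeneous d) {k : ℕ} (hk : d ≤ k) :
    degreePart (J ⊔ Ideal.span {f}) k = degreePart J k ⊔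
      (homogeneousSubmodule (Fin n) K (k - d)).map (LinearMap.mulLeft K f) := by
  apply le_antisymm
  · rintro p ⟨hp, hpJ⟩
    obtain ⟨j, hj, a, ha, rfl⟩ := Submodule.mem_sup.mp hpJ
    obtain ⟨b, rfl⟩ := Ideal.mem_span_singleton.mp ha
    rw [← homogeneousComponent_eq_self hp, map_add, hf.homogeneousComponent_mul, if_pos hk]
    exact Submodule.add_mem_sup
      ⟨homogeneousComponent_mem k j, homogeneousComponent_mem_of_mem hJ hj k⟩
      ⟨_, homogeneousComponent_mem _ b, rfl⟩
  · refine sup_le (inf_le_inf_left _ fun p hp => Ideal.mem_sup_left hp) ?_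
    rintro _ ⟨p, hp, rfl⟩
    refine ⟨?_, Ideal.mem_sup_right (Ideal.mul_mem_right _ _ (Ideal.mem_span_singleton_self f))⟩
    have := hf.mul ((mem_homogeneousSubmodule _ _).mp hp)
    rwa [Nat.add_sub_cancel' hk] at this

theorem degreePart_sup_span_of_lt (hJ : J.IsHomogeneous (homogeneousSubmodule (Fin n) K))
    (hf : f.IsHomogeneous d) {k : ℕ} (hk : ¬ d ≤ k) :
    degreePart (J ⊔ Ideal.span {f}) k = degreePart J k := by
  refine le_antisymm ?_ (inf_le_inf_left _ fun p hp => Ideal.mem_sup_left hp)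
  rintro p ⟨hp, hpJ⟩
  obtain ⟨j, hj, a, ha, rfl⟩ := Submodule.mem_sup.mp hpJ
  obtain ⟨b, rfl⟩ := Ideal.mem_span_singleton.mp ha
  rw [← homogeneousComponent_eq_self hp, map_add, hf.homogeneousComponent_mul, if_neg hk,
    add_zero]
  exact ⟨homogeneousComponent_mem k j, homogeneousComponent_mem_of_mem hJ hj k⟩

theorem degreePart_inf_map_mulLeft (hf : f.IsHomogeneous d) (hreg : ∀ p, f * p ∈ J → p ∈ J)
    {k : ℕ} (hk : d ≤ k) :
    degreePart J k ⊓ (homogeneousSubmodule (Fin n) K (k - d)).map (LinearMap.mulLeft K f) =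
      (degreePart J (k - d)).map (LinearMap.mulLeft K f) := by
  apply le_antisymm
  · rintro _ ⟨⟨-, hJ⟩, p, hp, rfl⟩
    exact ⟨p, ⟨hp, hreg p hJ⟩, rfl⟩
  · rintro _ ⟨p, ⟨hp, hpJ⟩, rfl⟩
    refine ⟨⟨?_, Ideal.mul_mem_left J f hpJ⟩, p, hp, rfl⟩
    have := hf.mul ((mem_homogeneousSubmodule _ _).mp hp)
    rwa [Nat.add_sub_cancel' hk] at this

theorem quotientHilbertSeries_sup_span
    (hJ : J.IsHomogeneous (homogeneousSubmodule (Fin n) K)) (hf : f.IsHomogeneous d)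
    (hreg : ∀ p, f * p ∈ J → p ∈ J) :
    quotientHilbertSeries (J ⊔ Ideal.span {f}) =
      (1 - PowerSeries.X ^ d) * quotientHilbertSeries J := by
  rcases eq_or_ne f 0 with rfl | hf0
  · have htop : J = ⊤ := (Ideal.eq_top_iff_one J).mpr (hreg 1 (by simp))
    have h0 : quotientHilbertSeries (⊤ : Ideal (MvPolynomial (Fin n) K)) = 0 :=
      PowerSeries.ext fun k => (coeff_quotientHilbertSeries_eq_zero_iff _ k).mpr (by simp)
    simp [htop, h0]
  ext k
  rw [sub_mul, one_mul, map_sub, PowerSeries.coeff_X_pow_mul']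
  split_ifs with hk
  · have hinj : Function.Injective (LinearMap.mulLeft K f) := mul_right_injective₀ hf0
    have h := Submodule.finrank_sup_add_finrank_inf_eq (degreePart J k)
      ((homogeneousSubmodule (Fin n) K (k - d)).map (LinearMap.mulLeft K f))
    rw [← degreePart_sup_span hJ hf hk, degreePart_inf_map_mulLeft hf hreg hk,
      ← (Submodule.equivMapOfInjective _ hinj _).finrank_eq,
      ← (Submodule.equivMapOfInjective _ hinj _).finrank_eq] at h
    simp only [quotientHilbertSeries, PowerSeries.coeff_mk]
    omega
  · rw [quotientHilbertSeries, quotientHilbertSeries, PowerSeries.coeff_mk, PowerSeries.coeff_mk,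
      degreePart_sup_span_of_lt hJ hf hk, sub_zero]

end

theorem mem_of_isWeaklyRegular_append_singleton {R : Type} [CommRing R] {rs : List R} {r : R}
    (h : IsWeaklyRegular R (rs ++ [r])) (p : R) (hp : r * p ∈ Ideal.ofList rs) :
    p ∈ Ideal.ofList rs := by
  rw [isWeaklyRegular_append_iff, isWeaklyRegular_singleton_iff,
    isSMulRegular_quotient_iff_mem_of_smul_mem] at h
  simpa using h.2 p (by simpa using hp)

theorem quotientHilbertSeries_ofList {d : ℕ} (rs : List (MvPolynomial (Fin n) K))
    (hrs : ∀ r ∈ rs, r.IsHomogeneous d) (h : IsWeaklyRegular (MvPolynomial (Fin n) K) rs) :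
    quotientHilbertSeries (Ideal.ofList rs) =
      (1 - PowerSeries.X ^ d) ^ rs.length *
        quotientHilbertSeries (⊥ : Ideal (MvPolynomial (Fin n) K)) := by
  induction rs using List.reverseRecOn with
  | nil => simp
  | append_singleton rs r ih =>
    have hrs' : ∀ s ∈ rs, s.IsHomogeneous d := fun s hs => hrs s (by simp [hs])
    have hJ : (Ideal.ofList rs).IsHomogeneous (homogeneousSubmodule (Fin n) K) :=
      Ideal.homogeneous_span _ _ fun s hs => ⟨d, hrs' s hs⟩
    rw [Ideal.ofList_append, Ideal.ofList_singleton,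
      quotientHilbertSeries_sup_span hJ (hrs r (by simp))
        (mem_of_isWeaklyRegular_append_singleton h),
      ih hrs' ((isWeaklyRegular_append_iff _ _ _).mp h).1, List.length_append,
      List.length_singleton, pow_succ', mul_assoc]

theorem isWeaklyRegular_map_X (l : List (Fin n)) (hl : l.Nodup) :
    IsWeaklyRegular (MvPolynomial (Fin n) K) (l.map (X (R := K))) := by
  induction l using List.reverseRecOn with
  | nil => simp
  | append_singleton l i ih =>
    rw [List.nodup_append] at hl
    rw [List.map_append, isWeaklyRegular_append_iff]
    refine ⟨ih hl.1, ?_⟩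
    have hspan : (Ideal.ofList (l.map (X (R := K))) • ⊤ : Submodule (MvPolynomial (Fin n) K) _) =
        Ideal.span (X '' {j | j ∈ l}) := by
      simp [Ideal.ofList, Set.image]
    rw [List.map_singleton, isWeaklyRegular_singleton_iff,
      isSMulRegular_quotient_iff_mem_of_smul_mem, hspan]
    intro p hp
    rw [mem_ideal_span_X_image] at hp ⊢
    intro m hm
    obtain ⟨j, hj, hne⟩ := hp (Finsupp.single i 1 + m) (by
      rw [smul_eq_mul, mem_support_iff, coeff_X_mul]
      exact mem_support_iff.mp hm)
    refine ⟨j, hj, ?_⟩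
    have hij : j ≠ i := fun h => hl.2.2 j hj i (by simp) h
    simpa [Finsupp.single_eq_of_ne hij] using hne

theorem ofList_map_X_finRange :
    Ideal.ofList ((List.finRange n).map X) = idealOfVars (Fin n) K := by
  simp only [Ideal.ofList, List.mem_map, List.mem_finRange, true_and]
  rfl

theorem isHomogeneous_mem_idealOfVars {k : ℕ} (hk : k ≠ 0) {p : MvPolynomial (Fin n) K}
    (hp : p.IsHomogeneous k) : p ∈ idealOfVars (Fin n) K := by
  rw [← pow_one (idealOfVars (Fin n) K), mem_pow_idealOfVars_iff]
  intro m hm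
  have := hp.degree_eq_sum_deg_support hm
  rw [Finsupp.degree_apply]
  omega

/-- A complete intersection of `n` quadrics in `n` variables contains all forms of degree
greater than `n`. -/
theorem pow_idealOfVars_le_ofList_of_quadrics (rs : List (MvPolynomial (Fin n) K))
    (hlen : rs.length = n) (hrs : ∀ r ∈ rs, r.IsHomogeneous 2)
    (h : IsWeaklyRegular (MvPolynomial (Fin n) K) rs) :
    idealOfVars (Fin n) K ^ (n + 1) ≤ Ideal.ofList rs := by
  have hx := quotientHilbertSeries_ofList (d := 1) (K := K) ((List.finRange n).map X)
    (by simp [isHomogeneous_X]) (isWeaklyRegular_map_X _ (List.nodup_finRange n))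
  have hr := quotientHilbertSeries_ofList rs hrs h
  rw [ofList_map_X_finRange, List.length_map, List.length_finRange, pow_one] at hx
  have hconst : quotientHilbertSeries (idealOfVars (Fin n) K) =
      PowerSeries.C (PowerSeries.coeff 0 (quotientHilbertSeries (idealOfVars (Fin n) K))) := by
    ext k
    rw [PowerSeries.coeff_C]
    split_ifs with hk
    · rw [hk]
    · exact (coeff_quotientHilbertSeries_eq_zero_iff _ k).mpr fun p =>
        isHomogeneous_mem_idealOfVars hk
  rw [hlen, show (1 - PowerSeries.X ^ 2 : PowerSeries ℤ) =
    (1 + PowerSeries.X) * (1 - PowerSeries.X) by ring, mul_pow, mul_assoc, ← hx, hconst] at hr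
  have hpoly : ((1 + PowerSeries.X) ^ n : PowerSeries ℤ) =
      ((1 + Polynomial.X : Polynomial ℤ) ^ n : Polynomial ℤ) := by simp
  have hcoeff : PowerSeries.coeff (n + 1) (quotientHilbertSeries (Ideal.ofList rs)) = 0 := by
    rw [hr, PowerSeries.coeff_mul_C, hpoly, Polynomial.coeff_coe, Polynomial.coeff_one_add_X_pow,
      Nat.choose_succ_self, Nat.cast_zero, zero_mul]
  rw [pow_idealOfVars_eq_span, Ideal.span_le]
  rintro _ ⟨m, hm, rfl⟩
  exact (coeff_quotientHilbertSeries_eq_zero_iff _ _).mp hcoeff _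
    (isHomogeneous_monomial _ hm)

end HilbertSeries

section Contraction

theorem List.prod_map_mul_of_commute {ι M : Type*} [Monoid M] (l : List ι) (a b : ι → M)
    (h : ∀ i j, Commute (a i) (b j)) :
    (l.map fun i => a i * b i).prod = (l.map a).prod * (l.map b).prod := by
  induction l with
  | nil => simp
  | cons i l ih =>
    have hc : Commute (b i) (l.map a).prod := Commute.list_prod_right _ _ fun x hx => by
      obtain ⟨j, -, rfl⟩ := List.mem_map.mp hx
      exact (h j i).symm
    simp only [List.map_cons, List.prod_cons, ih, mul_assoc]
    rw [← mul_assoc (b i), hc.eq, mul_assoc]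

variable {K : Type} [Field K] {n : ℕ}

theorem MvPolynomial.commute_pderiv (i j : Fin n) :
    Commute ((pderiv i).toLinearMap : Module.End K (MvPolynomial (Fin n) K))
      (pderiv j).toLinearMap := by
  refine LinearMap.ext fun p => ?_
  have h : ⁅(pderiv i : Derivation K (MvPolynomial (Fin n) K) (MvPolynomial (Fin n) K)),
      (pderiv j : Derivation K (MvPolynomial (Fin n) K) (MvPolynomial (Fin n) K))⁆ = 0 :=
    MvPolynomial.derivation_ext fun k => by
      classical
      rw [Derivation.commutator_apply, pderiv_X, pderiv_X, Pi.single_apply, Pi.single_apply]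
      split_ifs <;> simp
  have := congrArg (fun D => D p) h
  simpa [Derivation.commutator_apply, sub_eq_zero] using this

theorem monOp_add (d e : Fin n →₀ ℕ) : monOp n K (d + e) = monOp n K d * monOp n K e := by
  simp only [monOp, Finsupp.add_apply, pow_add]
  exact List.prod_map_mul_of_commute _ _ _ fun i j => (commute_pderiv i j).pow_pow _ _

theorem monOp_zero : monOp n K 0 = 1 := by
  simp [monOp]

theorem monOp_single (i : Fin n) : monOp n K (Finsupp.single i 1) = (pderiv i).toLinearMap := by
  rw [monOp, List.prod_map_eq_pow_single i]
  · simp [List.count_eq_one_of_mem (List.nodup_finRange n) (List.mem_finRange i)]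
  · intro j hj _
    simp [Finsupp.single_eq_of_ne hj]

theorem contr_monomial (F : MvPolynomial (Fin n) K) (d : Fin n →₀ ℕ) (c : K) :
    contr F (monomial d c) = c • monOp n K d F := by
  have h := (basisMonomials (Fin n) K).constr_basis K (fun d => monOp n K d F) d
  rw [coe_basisMonomials] at h
  rw [← mul_one c, ← smul_eq_mul, ← smul_monomial, map_smul, smul_eq_mul, mul_one]
  exact congrArg (c • ·) h

theorem contr_mul (F p q : MvPolynomial (Fin n) K) : contr F (p * q) = contr (contr F q) p := by
  induction p using MvPolynomial.induction_on' with
  | monomial d c =>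
    induction q using MvPolynomial.induction_on' with
    | monomial e b =>
      simp only [monomial_mul, contr_monomial, monOp_add, Module.End.mul_apply, map_smul, mul_smul]
    | add q r hq hr =>
      simp only [contr_monomial] at hq hr
      simp only [mul_add, map_add, hq, hr, contr_monomial, smul_add]
  | add p r hp hr => simp only [add_mul, map_add, hp, hr]

theorem contr_zero_left (p : MvPolynomial (Fin n) K) : contr 0 p = 0 := by
  induction p using MvPolynomial.induction_on' with
  | monomial d c => simp [contr_monomial]
  | add p q hp hq => rw [map_add, hp, hq, add_zero]

/-- The annihilator ideal of `F` under contraction. -/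
def annIdeal (F : MvPolynomial (Fin n) K) : Ideal (MvPolynomial (Fin n) K) where
  carrier := {g | contr F g = 0}
  add_mem' {g h} hg hh := by
    change contr F (g + h) = 0
    rw [map_add, show contr F g = 0 from hg, show contr F h = 0 from hh, add_zero]
  zero_mem' := map_zero (contr F)
  smul_mem' c g hg := by
    change contr F (c * g) = 0
    rw [contr_mul, show contr F g = 0 from hg, contr_zero_left]

/-- A nonzero form of degree `k` is not killed by all differential monomials of degree `k`. -/
theorem exists_monOp_ne_zero [CharZero K] {k : ℕ} {F : MvPolynomial (Fin n) K}
    (hF : F ≠ 0) (hhom : F.IsHomogeneous k) :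
    ∃ d : Fin n →₀ ℕ, d.degree = k ∧ monOp n K d F ≠ 0 := by
  induction k generalizing F with
  | zero => exact ⟨0, by simp, by simpa [monOp_zero] using hF⟩
  | succ k ih =>
    obtain ⟨i, hi⟩ : ∃ i, pderiv i F ≠ 0 := by
      by_contra! h
      have := hhom.sum_X_mul_pderiv
      simp only [h, mul_zero, Finset.sum_const_zero] at this
      exact smul_ne_zero (Nat.succ_ne_zero k) hF this.symm
    obtain ⟨d, hd, hne⟩ := ih hi hhom.pderiv
    refine ⟨d + Finsupp.single i 1, by simp [hd], ?_⟩
    rwa [monOp_add, monOp_single]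

end Contraction

theorem MvPolynomial.sub_C_constantCoeff_mem_idealOfVars {K : Type} [Field K] {n : ℕ}
    (c : MvPolynomial (Fin n) K) : c - C (constantCoeff c) ∈ idealOfVars (Fin n) K := by
  rw [← pow_one (idealOfVars (Fin n) K), mem_pow_idealOfVars_iff']
  intro m hm
  rw [(Finsupp.degree_eq_zero_iff m).mp (by omega)]
  simp [constantCoeff_eq]

/-- If `F` is homogeneous of degree `n` and `f_1, …, f_n` are
homogeneous quadratic forms annihilating `F` which form a regular sequence in
`R`, then `Ann_R(F) = (f_1, …, f_n)`; in particular `A(F)` is a quadratic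
complete intersection. -/
theorem ann_eq_span_of_regular_sequence_of_quadrics
    {K : Type} [Field K] [CharZero K] {n : ℕ}
    (F : MvPolynomial (Fin n) K) (hF : F ≠ 0) (hhom : F.IsHomogeneous n)
    (f : Fin n → MvPolynomial (Fin n) K)
    (hq : ∀ i, (f i).IsHomogeneous 2)
    (hann : ∀ i, contr F (f i) = 0)
    (hreg : RingTheory.Sequence.IsRegular (MvPolynomial (Fin n) K) (List.ofFn f)) :
    {g : MvPolynomial (Fin n) K | contr F g = 0} = ↑(Ideal.span (Set.range f)) := by
  have hI : Ideal.ofList (List.ofFn f) = Ideal.span (Set.range f) := by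
    simp only [Ideal.ofList, List.mem_ofFn]
    rfl
  have hq' : ∀ r ∈ List.ofFn f, r.IsHomogeneous 2 := by
    simpa [List.mem_ofFn] using hq
  have hpow := pow_idealOfVars_le_ofList_of_quadrics _ List.length_ofFn hq' hreg.toIsWeaklyRegular
  obtain ⟨s, hs, hgen⟩ := exists_generator_socle (ofList_map_X_finRange (n := n) (K := K))
    (isWeaklyRegular_map_X _ (List.nodup_finRange n)) hreg.toIsWeaklyRegular (by simp)
    fun r hr => isHomogeneous_mem_idealOfVars two_ne_zero (hq' r hr)
  rw [hI] at hpow hs hgen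
  have hle : Ideal.span (Set.range f) ≤ annIdeal F :=
    Ideal.span_le.mpr (Set.range_subset_iff.mpr hann)
  have hgen' : ∀ u, (∀ x ∈ idealOfVars (Fin n) K, x * u ∈ Ideal.span (Set.range f)) →
      ∃ b : K, u - C b * s ∈ Ideal.span (Set.range f) := by
    intro u hu
    obtain ⟨c, hc⟩ := hgen u hu
    refine ⟨constantCoeff c, ?_⟩
    convert add_mem hc (hs _ (sub_C_constantCoeff_mem_idealOfVars c)) using 1
    ring
  have hcontr : ∀ u (b : K), u - C b * s ∈ Ideal.span (Set.range f) →
      contr F u = b • contr F s := by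
    intro u b h
    have : contr F (u - C b * s) = 0 := hle h
    rwa [map_sub, C_mul', map_smul, sub_eq_zero] at this
  have hs0 : contr F s ≠ 0 := by
    obtain ⟨d, hd, hne⟩ := exists_monOp_ne_zero hF hhom
    obtain ⟨b, hb⟩ := hgen' (monomial d 1) fun x hx => hpow (by
      rw [pow_succ']
      exact Ideal.mul_mem_mul hx ((monomial_mem_pow_idealOfVars_iff _ _ one_ne_zero).mpr hd.ge))
    intro h
    have := hcontr _ b hb
    rw [h, smul_zero, contr_monomial, one_smul] at this
    exact hne this
  have hsocle : ∀ u, contr F u = 0 →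
      (∀ x ∈ idealOfVars (Fin n) K, x * u ∈ Ideal.span (Set.range f)) →
      u ∈ Ideal.span (Set.range f) := by
    intro u hu hx
    obtain ⟨b, hb⟩ := hgen' u hx
    have hb0 : b = 0 := (smul_eq_zero.mp ((hcontr u b hb).symm.trans hu)).resolve_right hs0
    simpa [hb0] using hb
  have hmain : ∀ k u, contr F u = 0 →
      (∀ x ∈ idealOfVars (Fin n) K ^ k, x * u ∈ Ideal.span (Set.range f)) →
      u ∈ Ideal.span (Set.range f) := by
    intro k
    induction k with
    | zero =>
      intro u _ hx
      simpa using hx 1 (by simp)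
    | succ k ih =>
      refine fun u hu hx => hsocle u hu fun y hy => ih _ ((annIdeal F).mul_mem_left y hu) ?_
      intro x hxk
      rw [← mul_assoc]
      exact hx _ (pow_succ (idealOfVars (Fin n) K) k ▸ Ideal.mul_mem_mul hxk hy)
  exact Set.Subset.antisymm
    (fun g hg => hmain (n + 1) g hg fun x hx => Ideal.mul_mem_right _ _ (hpow hx)) hle
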